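/- Define Ψ : Conv(ℝ,ℝ) → M(ℝ) by Ψ(f) = δ₀ (the Dirac measure at 0) if f is not differentiable at 0, and Ψ(f) = 0 otherwise. Then: (i) Ψ is a local functional; (ii) Ψ is not continuous; (iii) Ψ is not a valuation: for f(x) = −2x for x ≤ 0 and f(x) = −x for x > 0, and h(x) = −x for x ≤ 0 and h(x) = 0 for x > 0, the pointwise minimum f ∧ h (equal to x ↦ −x) is convex, yet Ψ(f) + Ψ(h) ≠ Ψ(f ∨ h) + Ψ(f ∧ h). -/

import Mathlib

open scoped CompactlySupported

noncomputable section

/-- The space of complex Radon measures on `ℝ`, identified with the topological dual of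
`C_c(ℝ, ℂ)`: linear functionals bounded on the subspace of functions supported in any
fixed compact set. -/
def RadonMeasureR : Submodule ℂ (C_c(ℝ, ℂ) →ₗ[ℂ] ℂ) where
  carrier := {μ | ∀ A : Set ℝ, IsCompact A → ∃ C : ℝ, ∀ φ : C_c(ℝ, ℂ),
      tsupport ⇑φ ⊆ A → (∀ x, ‖φ x‖ ≤ 1) → ‖μ φ‖ ≤ C}
  add_mem' := by
    intro μ ν hμ hν A hA
    obtain ⟨C₁, h₁⟩ := hμ A hA
    obtain ⟨C₂, h₂⟩ := hν A hA
    refine ⟨C₁ + C₂, fun φ h h' => ?_⟩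
    calc ‖(μ + ν) φ‖ = ‖μ φ + ν φ‖ := by simp
    _ ≤ ‖μ φ‖ + ‖ν φ‖ := norm_add_le _ _
    _ ≤ C₁ + C₂ := add_le_add (h₁ φ h h') (h₂ φ h h')
  zero_mem' := fun _ _ => ⟨0, fun φ _ _ => by simp⟩
  smul_mem' := by
    intro c μ hμ A hA
    obtain ⟨C, h⟩ := hμ A hA
    refine ⟨‖c‖ * C, fun φ hs hb => ?_⟩
    simp only [LinearMap.smul_apply, norm_smul]
    exact mul_le_mul_of_nonneg_left (h φ hs hb) (norm_nonneg c)

/-- The space `Conv(ℝ, ℝ)` of (finite, hence continuous) convex functions on `ℝ`, with the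
topology of uniform convergence on compact subsets. -/
abbrev ConvFnR := {f : C(ℝ, ℝ) // ConvexOn ℝ Set.univ ⇑f}

/-- `Ψ` is a local functional. -/
def IsLocalFunctionalR (Ψ : ConvFnR → RadonMeasureR) : Prop :=
  ∀ (f h : ConvFnR) (U : Set ℝ), IsOpen U → (∀ x ∈ U, f.1 x = h.1 x) →
    ∀ φ : C_c(ℝ, ℂ), tsupport ⇑φ ⊆ U → (Ψ f).1 φ = (Ψ h).1 φ

/-- Continuity (w.r.t. locally uniform convergence and the weak* topology). -/
def IsContinuousFunctionalR (Ψ : ConvFnR → RadonMeasureR) : Prop :=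
  ∀ φ : C_c(ℝ, ℂ), Continuous fun f : ConvFnR => (Ψ f).1 φ

/-- The Dirac measure at `0`. -/
def diracZero : RadonMeasureR :=
  ⟨{ toFun := fun φ => φ 0
     map_add' := by intro φ ψ; simp
     map_smul' := by intro c φ; simp },
   fun A _ => ⟨1, fun φ _ hb => hb 0⟩⟩

open Classical in
/-- The functional `Ψ(f) = δ₀` if `f` is not differentiable at `0`, and `Ψ(f) = 0` otherwise. -/
def PsiDiff : ConvFnR → RadonMeasureR := fun f =>
  if DifferentiableAt ℝ (⇑f.1) 0 then 0 else diracZero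

lemma convexOn_mulLeft (c : ℝ) : ConvexOn ℝ Set.univ fun x : ℝ => c * x := by
  refine ⟨convex_univ, fun x _ y _ a b _ _ _ => le_of_eq ?_⟩
  simp only [smul_eq_mul]
  ring

lemma convexOn_negId : ConvexOn ℝ Set.univ fun x : ℝ => -x := by
  have := convexOn_mulLeft (-1)
  simpa [neg_one_mul] using this

/-- `f(x) = -2x` for `x ≤ 0`, `f(x) = -x` for `x > 0`; equivalently `f = max(-2x, -x)`. -/
def fEx : ConvFnR :=
  ⟨⟨fun x => max (-2 * x) (-x), by continuity⟩,
    (convexOn_mulLeft (-2)).sup convexOn_negId⟩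

/-- `h(x) = -x` for `x ≤ 0`, `h(x) = 0` for `x > 0`; equivalently `h = max(-x, 0)`. -/
def hEx : ConvFnR :=
  ⟨⟨fun x => max (-x) 0, by continuity⟩,
    convexOn_negId.sup (convexOn_const 0 convex_univ)⟩

lemma fEx_piecewise : ∀ x : ℝ, (x ≤ 0 → fEx.1 x = -2 * x) ∧ (0 < x → fEx.1 x = -x) := by
  intro x
  constructor
  · intro hx
    exact max_eq_left (by linarith)
  · intro hx
    exact max_eq_right (by linarith)

lemma hEx_piecewise : ∀ x : ℝ, (x ≤ 0 → hEx.1 x = -x) ∧ (0 < x → hEx.1 x = 0) := by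
  intro x
  constructor
  · intro hx
    exact max_eq_left (by linarith)
  · intro hx
    exact max_eq_right (by linarith)

lemma inf_fEx_hEx : ⇑fEx.1 ⊓ ⇑hEx.1 = fun x : ℝ => -x := by
  funext x
  show min (max (-2 * x) (-x)) (max (-x) 0) = -x
  rcases le_or_gt x 0 with hx | hx
  · rw [max_eq_left (by linarith : -x ≤ -2 * x), max_eq_left (by linarith : (0:ℝ) ≤ -x),
      min_eq_right (by linarith : -x ≤ -2 * x)]
  · rw [max_eq_right (by linarith : -2 * x ≤ -x), max_eq_right (by linarith : -x ≤ (0:ℝ)),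
      min_eq_left (by linarith : -x ≤ (0:ℝ))]

/-- The pointwise minimum `fEx ⊓ hEx` (which equals `x ↦ -x` and hence is convex). -/
def minEx : ConvFnR :=
  ⟨fEx.1 ⊓ hEx.1, by
    have : ⇑(fEx.1 ⊓ hEx.1) = fun x : ℝ => -x := by
      rw [ContinuousMap.coe_inf]; exact inf_fEx_hEx
    rw [this]; exact convexOn_negId⟩

/-- The pointwise maximum `fEx ⊔ hEx`. -/
def maxEx : ConvFnR := ⟨fEx.1 ⊔ hEx.1, fEx.2.sup hEx.2⟩

/-- A hat function with value `1` at `0`. -/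
def hatFn : C_c(ℝ, ℂ) where
  toFun := fun x => ((max (1 - |x|) 0 : ℝ) : ℂ)
  continuous_toFun := by fun_prop
  hasCompactSupport' := by
    refine HasCompactSupport.intro (isCompact_Icc (a := (-1 : ℝ)) (b := 1)) fun x hx => ?_
    have h1 : ¬ |x| ≤ 1 := fun h => hx (abs_le.mp h)
    have : max (1 - |x|) 0 = 0 := max_eq_right (by linarith)
    simp [this]

lemma hatFn_zero : hatFn 0 = 1 := by
  show ((max (1 - |(0:ℝ)|) 0 : ℝ) : ℂ) = 1
  simp

lemma not_diff_of_kink {g : ℝ → ℝ} {a b : ℝ} (hab : a ≠ b) (h1 : ∀ x ≤ 0, g x = a * x)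
    (h2 : ∀ x, 0 ≤ x → g x = b * x) : ¬ DifferentiableAt ℝ g 0 := by
  intro h
  have hd := h.hasDerivAt
  have ha : HasDerivWithinAt g a (Set.Iic 0) 0 := by
    have := ((hasDerivAt_id (0:ℝ)).const_mul a).hasDerivWithinAt (s := Set.Iic 0)
    rw [mul_one] at this
    exact this.congr (fun x hx => h1 x hx) (h1 0 le_rfl)
  have hb : HasDerivWithinAt g b (Set.Ici 0) 0 := by
    have := ((hasDerivAt_id (0:ℝ)).const_mul b).hasDerivWithinAt (s := Set.Ici 0)
    rw [mul_one] at this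
    exact this.congr (fun x hx => h2 x hx) (h2 0 le_rfl)
  have e1 := (uniqueDiffWithinAt_Iic (0:ℝ)).eq_deriv _ ha hd.hasDerivWithinAt
  have e2 := (uniqueDiffWithinAt_Ici (0:ℝ)).eq_deriv _ hb hd.hasDerivWithinAt
  exact hab (e1.trans e2.symm)

lemma PsiDiff_kink {f : ConvFnR} {a b : ℝ} (hab : a ≠ b) (h1 : ∀ x ≤ 0, f.1 x = a * x)
    (h2 : ∀ x, 0 ≤ x → f.1 x = b * x) : PsiDiff f = diracZero :=
  if_neg (not_diff_of_kink hab h1 h2)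

lemma dirac_hat : diracZero.1 hatFn = 1 := hatFn_zero

/-- The functions `x ↦ |t| |x|`. -/
def absFam (t : ℝ) : ConvFnR :=
  ⟨⟨fun x => |t| * |x|, by fun_prop⟩, by
    have := (convexOn_univ_norm (E := ℝ)).smul (abs_nonneg t)
    simpa using this⟩

lemma continuous_absFam : Continuous absFam := by
  refine Continuous.subtype_mk ?_ _
  refine ContinuousMap.continuous_of_continuous_uncurry _ ?_
  show Continuous fun p : ℝ × ℝ => |p.1| * |p.2|
  fun_prop

/-- The functional `Ψ(f) = δ₀` if `f` is not differentiable at `0` and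
`Ψ(f) = 0` otherwise is a local functional which is neither continuous nor a valuation:
for the explicit convex functions `fEx`, `hEx` above, whose pointwise minimum is convex,
`Ψ(fEx) + Ψ(hEx) ≠ Ψ(fEx ⊔ hEx) + Ψ(fEx ⊓ hEx)`. -/
theorem psiDiff_local_not_continuous_not_valuation :
    IsLocalFunctionalR PsiDiff ∧
    ¬ IsContinuousFunctionalR PsiDiff ∧
    (ConvexOn ℝ Set.univ (⇑fEx.1 ⊓ ⇑hEx.1) ∧
      PsiDiff fEx + PsiDiff hEx ≠ PsiDiff maxEx + PsiDiff minEx) := by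
  refine ⟨?_, ?_, ?_, ?_⟩
  · intro f h U hU hfh φ hφ
    by_cases h0 : (0:ℝ) ∈ U
    · have he : (⇑f.1) =ᶠ[nhds 0] (⇑h.1) := by
        filter_upwards [hU.mem_nhds h0] with x hx using hfh x hx
      have := he.differentiableAt_iff (𝕜 := ℝ)
      have hP : PsiDiff f = PsiDiff h := by
        by_cases hd : DifferentiableAt ℝ (⇑h.1) 0
        · exact (if_pos (this.mpr hd)).trans (if_pos hd).symm
        · exact (if_neg (mt this.mp hd)).trans (if_neg hd).symm
      rw [hP]
    · have hz : φ 0 = 0 := image_eq_zero_of_notMem_tsupport fun h => h0 (hφ h)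
      have key : ∀ g : ConvFnR, (PsiDiff g).1 φ = 0 := by
        intro g
        unfold PsiDiff
        split_ifs
        · rfl
        · exact hz
      rw [key, key]
  · intro hc
    have hcont : Continuous fun t : ℝ => (PsiDiff (absFam t)).1 hatFn :=
      (hc hatFn).comp continuous_absFam
    have h0 : (PsiDiff (absFam 0)).1 hatFn = 0 := by
      have hd : DifferentiableAt ℝ (⇑(absFam 0).1) 0 := by
        have : (⇑(absFam 0).1) = fun _ => (0:ℝ) := by
          funext x
          show |(0:ℝ)| * |x| = 0
          simp
        rw [this]
        exact differentiableAt_const _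
      have : PsiDiff (absFam 0) = 0 := if_pos hd
      rw [this]; rfl
    have h1 : ∀ t : ℝ, t ≠ 0 → (PsiDiff (absFam t)).1 hatFn = 1 := by
      intro t ht
      have hp := abs_pos.mpr ht
      rw [PsiDiff_kink (a := -|t|) (b := |t|) (by intro h; linarith)]
      · exact dirac_hat
      · intro x hx
        show |t| * |x| = _
        rw [abs_of_nonpos hx]; ring
      · intro x hx
        show |t| * |x| = _
        rw [abs_of_nonneg hx]
    have ht := (hcont.tendsto 0).mono_left (nhdsWithin_le_nhds (s := {0}ᶜ))
    rw [h0] at ht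
    have ht' : Filter.Tendsto (fun t : ℝ => (PsiDiff (absFam t)).1 hatFn)
        (nhdsWithin 0 {0}ᶜ) (nhds 1) := by
      refine tendsto_const_nhds.congr' ?_
      filter_upwards [self_mem_nhdsWithin] with t ht using (h1 t ht).symm
    exact zero_ne_one (tendsto_nhds_unique ht ht')
  · rw [inf_fEx_hEx]; exact convexOn_negId
  · have hf : PsiDiff fEx = diracZero := by
      refine PsiDiff_kink (a := -2) (b := -1) (by norm_num) (fun x hx => ?_) (fun x hx => ?_)
      · show max (-2 * x) (-x) = _
        exact max_eq_left (by linarith)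
      · show max (-2 * x) (-x) = _
        rw [max_eq_right (by linarith)]; ring
    have hh : PsiDiff hEx = diracZero := by
      refine PsiDiff_kink (a := -1) (b := 0) (by norm_num) (fun x hx => ?_) (fun x hx => ?_)
      · show max (-x) 0 = _
        rw [max_eq_left (by linarith)]; ring
      · show max (-x) 0 = _
        rw [max_eq_right (by linarith)]; ring
    have hM : PsiDiff maxEx = diracZero := by
      refine PsiDiff_kink (a := -2) (b := 0) (by norm_num) (fun x hx => ?_) (fun x hx => ?_)
      · show max (max (-2 * x) (-x)) (max (-x) 0) = _
        rw [max_eq_left (by linarith : -x ≤ -2 * x), max_eq_left (by linarith : 0 ≤ -x),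
          max_eq_left (by linarith)]
      · show max (max (-2 * x) (-x)) (max (-x) 0) = _
        rw [max_eq_right (by linarith : -2 * x ≤ -x), max_eq_right (by linarith : -x ≤ 0),
          max_eq_right (by linarith)]
        ring
    have hm : PsiDiff minEx = 0 := by
      refine if_pos ?_
      have : (⇑minEx.1) = fun x : ℝ => -x := inf_fEx_hEx
      rw [this]
      exact differentiableAt_id.neg
    rw [hf, hh, hM, hm]
    intro h
    have h2 := add_left_cancel h
    have h3 : diracZero.1 hatFn = 0 := by rw [h2]; rfl
    rw [dirac_hat] at h3
    exact one_ne_zero h3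

end
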